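/- For all real numbers x, y, z, w with 0 ≤ x ≤ y ≤ z ≤ w ≤ 1, one has M[M[x,y], M[z,w]] ≤ max{M[x,w], M[y,z]}. -/

import Mathlib

open MeasureTheory

noncomputable section

/-- The nonlinear mean `M[a,b] = (a+b)/√(4+(a-b)²)`. -/
def nlMean (a b : ℝ) : ℝ := (a + b) / Real.sqrt (4 + (a - b) ^ 2)

theorem nlMean_sq (a b : ℝ) : nlMean a b ^ 2 = (a + b) ^ 2 / (4 + (a - b) ^ 2) := by
  rw [nlMean, div_pow, Real.sq_sqrt (by positivity)]

theorem nlMean_nonneg {a b : ℝ} (ha : 0 ≤ a) (hb : 0 ≤ b) : 0 ≤ nlMean a b :=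
  div_nonneg (add_nonneg ha hb) (Real.sqrt_nonneg _)

theorem nlMean_le_iff {a b c : ℝ} (ha : 0 ≤ a) (hb : 0 ≤ b) (hc : 0 ≤ c) :
    nlMean a b ≤ c ↔ (a + b) ^ 2 ≤ c ^ 2 * (4 + (a - b) ^ 2) := by
  rw [← sq_le_sq₀ (nlMean_nonneg ha hb) hc, nlMean_sq, div_le_iff₀ (by positivity)]

theorem nlMean_comm (a b : ℝ) : nlMean a b = nlMean b a := by
  rw [nlMean, nlMean, add_comm a b, show (a - b) ^ 2 = (b - a) ^ 2 by ring]

theorem nlMean_self (a : ℝ) : nlMean a a = a := by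
  rw [nlMean, show (4 + (a - a) ^ 2 : ℝ) = 2 ^ 2 by ring, Real.sqrt_sq (by norm_num)]
  ring

theorem continuous_nlMean : Continuous fun p : ℝ × ℝ => nlMean p.1 p.2 := by
  unfold nlMean
  refine Continuous.div (by fun_prop) (by fun_prop) fun p => ?_
  exact (Real.sqrt_pos.2 (by positivity)).ne'

theorem nlMean_mono_left {a a' b : ℝ} (ha : 0 ≤ a) (haa' : a ≤ a') (hb : 0 ≤ b) (ha' : a' ≤ 1) :
    nlMean a b ≤ nlMean a' b := by
  rw [nlMean_le_iff ha hb (nlMean_nonneg (ha.trans haa') hb), nlMean_sq, div_mul_eq_mul_div,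
    le_div_iff₀ (by positivity)]
  have key : (a' + b) ^ 2 * (4 + (a - b) ^ 2) - (a + b) ^ 2 * (4 + (a' - b) ^ 2) =
      4 * (a' - a) * (a + a' + 2 * b + b * (b ^ 2 - a * a')) := by ring
  have h : 0 ≤ a + a' + 2 * b + b * (b ^ 2 - a * a') := by
    nlinarith [mul_nonneg hb (sub_nonneg.2 (mul_le_one₀ (haa'.trans ha') (ha.trans haa') ha')),
      pow_nonneg hb 3]
  nlinarith [mul_nonneg (sub_nonneg.2 haa') h]

theorem nlMean_mono {a a' b b' : ℝ} (ha : 0 ≤ a) (haa' : a ≤ a') (ha' : a' ≤ 1)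
    (hb : 0 ≤ b) (hbb' : b ≤ b') (hb' : b' ≤ 1) : nlMean a b ≤ nlMean a' b' := by
  refine (nlMean_mono_left ha haa' hb ha').trans ?_
  rw [nlMean_comm a', nlMean_comm a']
  exact nlMean_mono_left hb hbb' (ha.trans haa') hb'

theorem nlMean_le_one {a b : ℝ} (ha : 0 ≤ a) (ha' : a ≤ 1) (hb : 0 ≤ b) (hb' : b ≤ 1) :
    nlMean a b ≤ 1 :=
  (nlMean_mono ha ha' le_rfl hb hb' le_rfl).trans (nlMean_self 1).le

/-- A level curve of `nlMean` is a branch of a hyperbola. -/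
theorem eq_cosh_sinh_of_nlMean_eq {a b c θ : ℝ} (h : nlMean a b = c)
    (hθ : Real.sinh θ = (b - a) / 2) :
    a = c * Real.cosh θ - Real.sinh θ ∧ b = c * Real.cosh θ + Real.sinh θ := by
  have hs : Real.sqrt (4 + (a - b) ^ 2) = 2 * Real.cosh θ := by
    rw [Real.sqrt_eq_iff_mul_self_eq_of_pos (by positivity)]
    have hcosh := Real.cosh_sq θ
    rw [hθ] at hcosh
    linear_combination 4 * hcosh
  have hsum : a + b = c * (2 * Real.cosh θ) := by
    rw [← h, nlMean, hs, div_mul_cancel₀ _ (by positivity)]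
  constructor <;> linarith

/-- The means of two neighbouring pairs on a level curve, as perturbations of the points
`c * C - S` and `c * C + S` of the same curve. -/
theorem sq_add_sq_le_and_mul_le {c C S τ X Z P Q : ℝ} (hc : 0 ≤ c)
    (hCS : C ^ 2 = 1 + S ^ 2) (hS : 0 ≤ S) (hC : 0 ≤ C)
    (hX : X = c * C - S) (hZ : Z = c * C + S) (hX0 : 0 ≤ X) (hZ1 : Z ≤ 1)
    (hτ0 : 0 ≤ τ) (hτ1 : τ ≤ 1) (hP : 0 ≤ P) (hQ : 0 ≤ Q)
    (ha : 0 < 1 + τ * (X ^ 2 - c ^ 2)) (hb : 0 < 1 + τ * (Z ^ 2 - c ^ 2))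
    (hPX : P ^ 2 = X ^ 2 / (1 + τ * (X ^ 2 - c ^ 2)))
    (hQZ : Q ^ 2 = Z ^ 2 / (1 + τ * (Z ^ 2 - c ^ 2))) :
    P ^ 2 + Q ^ 2 ≤ X ^ 2 + Z ^ 2 ∧ P * Q ≤ X * Z := by
  have hZ0 : 0 ≤ Z := by rw [hZ]; positivity
  obtain ⟨m, hm⟩ : ∃ m, m = (1 + c ^ 2) * S ^ 2 := ⟨_, rfl⟩
  obtain ⟨n, hn⟩ : ∃ n, n = 2 * c * C * S := ⟨_, rfl⟩
  have hu : X ^ 2 = c ^ 2 + (m - n) := by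
    rw [hX, hm, hn]; linear_combination c ^ 2 * hCS
  have hv : Z ^ 2 = c ^ 2 + (m + n) := by
    rw [hZ, hm, hn]; linear_combination c ^ 2 * hCS
  have hm0 : 0 ≤ m := by rw [hm]; positivity
  have hn0 : 0 ≤ n := by rw [hn]; positivity
  have hmc : 0 ≤ 1 - c ^ 2 - m := by nlinarith
  have hprod : 0 ≤ 2 * m + (m ^ 2 - n ^ 2) := by
    have : 2 * m + (m ^ 2 - n ^ 2) =
        S ^ 2 * (2 * (1 - c ^ 2) + (1 - c ^ 2) ^ 2 * S ^ 2) := by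
      rw [hm, hn]; linear_combination -4 * c ^ 2 * S ^ 2 * hCS
    rw [this]
    have : 0 ≤ 1 - c ^ 2 := by linarith
    positivity
  have ea : 1 + τ * (X ^ 2 - c ^ 2) = 1 + τ * (m - n) := by rw [hu]; ring
  have eb : 1 + τ * (Z ^ 2 - c ^ 2) = 1 + τ * (m + n) := by rw [hv]; ring
  rw [ea] at ha hPX
  rw [eb] at hb hQZ
  have hτ1' : 0 ≤ 1 - τ := by linarith
  constructor
  · rw [hPX, hQZ, div_add_div _ _ ha.ne' hb.ne', div_le_iff₀ (mul_pos ha hb), hu, hv]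
    have h1 : 0 ≤ n ^ 2 * (1 - c ^ 2 - m) + m ^ 2 + c ^ 2 * m + (m + c ^ 2) * m ^ 2 := by
      positivity
    have h0 : 0 ≤ m ^ 2 + n ^ 2 + c ^ 2 * m := by positivity
    have h := mul_nonneg hτ0 (add_nonneg (mul_nonneg hτ1' h0) (mul_nonneg hτ0 h1))
    linear_combination 2 * h
  · have hge : 1 ≤ (1 + τ * (m - n)) * (1 + τ * (m + n)) := by
      have h := mul_nonneg hτ0 (add_nonneg (mul_nonneg hτ1' (by positivity : 0 ≤ 2 * m))
        (mul_nonneg hτ0 hprod))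
      linear_combination h
    rw [← sq_le_sq₀ (mul_nonneg hP hQ) (mul_nonneg hX0 hZ0), mul_pow, mul_pow, hPX, hQZ,
      div_mul_div_comm]
    exact div_le_self (by positivity) hge

theorem nlMean_hyperbola_sq {c C S D E X : ℝ} (hCS : C ^ 2 = 1 + S ^ 2)
    (hDE : D ^ 2 = 1 + E ^ 2) (hX : X = c * C - S) {x y : ℝ}
    (hx : x = c * (C * D + S * E) - (S * D + C * E))
    (hy : y = c * (C * D - S * E) - (S * D - C * E)) :
    0 < 1 + E ^ 2 / D ^ 2 * (X ^ 2 - c ^ 2) ∧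
      nlMean x y ^ 2 = X ^ 2 / (1 + E ^ 2 / D ^ 2 * (X ^ 2 - c ^ 2)) := by
  have hD : 0 < D ^ 2 := by rw [hDE]; positivity
  have hD0 : D ≠ 0 := by rintro rfl; norm_num at hD
  have e : 1 + E ^ 2 / D ^ 2 * (X ^ 2 - c ^ 2) = (1 + E ^ 2 * (C - c * S) ^ 2) / D ^ 2 := by
    rw [eq_div_iff hD.ne']
    field_simp
    rw [hX]
    linear_combination hDE + E ^ 2 * (c ^ 2 - 1) * hCS
  rw [e]
  refine ⟨by positivity, ?_⟩
  rw [nlMean_sq, show x + y = 2 * D * X by rw [hx, hy, hX]; ring,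
    show 4 + (x - y) ^ 2 = 4 * (1 + E ^ 2 * (C - c * S) ^ 2) by rw [hx, hy]; ring]
  have : 0 < 1 + E ^ 2 * (C - c * S) ^ 2 := by positivity
  field_simp
  ring

/-- The cross inequality when both crossed pairs lie on the same level curve. -/
theorem nlMean_nlMean_le_of_eq {x y z w c : ℝ} (hx : 0 ≤ x) (hxy : x ≤ y) (hyz : y ≤ z)
    (hzw : z ≤ w) (hw : w ≤ 1) (hxw : nlMean x w = c) (hyz' : nlMean y z = c) :
    nlMean (nlMean x y) (nlMean z w) ≤ c := by
  have hy : 0 ≤ y := hx.trans hxy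
  have hz : 0 ≤ z := hy.trans hyz
  have hw0 : 0 ≤ w := hz.trans hzw
  have hc : 0 ≤ c := hyz' ▸ nlMean_nonneg hy hz
  obtain ⟨θ, hθ⟩ := Real.sinh_surjective ((w - x) / 2)
  obtain ⟨φ, hφ⟩ := Real.sinh_surjective ((z - y) / 2)
  obtain ⟨ex, ew⟩ := eq_cosh_sinh_of_nlMean_eq hxw hθ
  obtain ⟨ey, ez⟩ := eq_cosh_sinh_of_nlMean_eq hyz' hφ
  have hφ0 : 0 ≤ φ := Real.sinh_nonneg_iff.1 (by linarith)
  have hφθ : φ ≤ θ := Real.sinh_le_sinh.1 (by linarith)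
  obtain ⟨μ, hμ⟩ : ∃ μ, μ = (θ + φ) / 2 := ⟨_, rfl⟩
  obtain ⟨δ, hδ⟩ : ∃ δ, δ = (θ - φ) / 2 := ⟨_, rfl⟩
  obtain rfl : θ = μ + δ := by linarith
  obtain rfl : φ = μ - δ := by linarith
  have hS : 0 ≤ Real.sinh μ := Real.sinh_nonneg_iff.2 (by linarith)
  have hE : 0 ≤ Real.sinh δ := Real.sinh_nonneg_iff.2 (by linarith)
  have hC := Real.one_le_cosh μ
  have hD := Real.one_le_cosh δ
  have hCS := Real.cosh_sq' μ
  have hDE := Real.cosh_sq' δ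
  rw [Real.cosh_add, Real.sinh_add] at ex ew
  rw [Real.cosh_sub, Real.sinh_sub] at ey ez
  generalize Real.cosh μ = C at *
  generalize Real.sinh μ = S at *
  generalize Real.cosh δ = D at *
  generalize Real.sinh δ = E at *
  have hX0 : 0 ≤ c * C - S := by
    have : 0 ≤ D * (c * C - S) := by linarith
    exact nonneg_of_mul_nonneg_right this (by linarith)
  have hZ0 : 0 ≤ c * C + S := by positivity
  have hZ1 : c * C + S ≤ 1 := by
    have h1 : c * C + S ≤ D * (c * C + S) := le_mul_of_one_le_left hZ0 hD
    have h2 : 0 ≤ c * (S * E) + C * E := by positivity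
    linarith
  obtain ⟨ha, hP⟩ := nlMean_hyperbola_sq hCS hDE rfl ex ey
  obtain ⟨hb, hQ⟩ := nlMean_hyperbola_sq (c := c) (C := C) (S := -S) (D := D) (E := E)
    (x := z) (y := w) (X := c * C + S) (by rw [hCS]; ring) hDE (by ring)
    (by rw [ez]; ring) (by rw [ew]; ring)
  have hP0 := nlMean_nonneg hx hy
  have hQ0 := nlMean_nonneg hz hw0
  obtain ⟨hsum, hmul⟩ := sq_add_sq_le_and_mul_le hc hCS hS (by linarith) rfl rfl hX0 hZ1
    (by positivity) (div_le_one_of_le₀ (by linarith) (by positivity)) hP0 hQ0 ha hb hP hQ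
  rw [nlMean_le_iff hP0 hQ0 hc]
  have hc1 : 0 ≤ 1 - c ^ 2 := by nlinarith
  nlinarith [mul_le_mul_of_nonneg_left hsum hc1,
    mul_le_mul_of_nonneg_left hmul (by positivity : 0 ≤ 2 * (1 + c ^ 2))]

/-- The values of `nlMean` on a segment cover all intermediate values. -/
theorem exists_nlMean_segment_eq {a b a' b' c : ℝ} (haa' : a ≤ a') (hbb' : b ≤ b')
    (h : nlMean a b ≤ c) (h' : c ≤ nlMean a' b') :
    ∃ t : ℝ, 0 ≤ t ∧ t ≤ 1 ∧ nlMean (a + t * (a' - a)) (b + t * (b' - b)) = c ∧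
      a ≤ a + t * (a' - a) ∧ a + t * (a' - a) ≤ a' ∧
      b ≤ b + t * (b' - b) ∧ b + t * (b' - b) ≤ b' := by
  have hcont : Continuous fun t : ℝ => nlMean (a + t * (a' - a)) (b + t * (b' - b)) :=
    continuous_nlMean.comp
      (f := fun t : ℝ => (a + t * (a' - a), b + t * (b' - b))) (by fun_prop)
  obtain ⟨t, ⟨h0, h1⟩, ht⟩ := intermediate_value_Icc zero_le_one hcont.continuousOn
    (show c ∈ Set.Icc _ _ from ⟨by simpa using h, by simpa using h'⟩)
  refine ⟨t, h0, h1, ht, ?_, ?_, ?_, ?_⟩ <;> nlinarith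

theorem nlMean_cross_inequality :
    ∀ x y z w : ℝ, 0 ≤ x → x ≤ y → y ≤ z → z ≤ w → w ≤ 1 →
      nlMean (nlMean x y) (nlMean z w) ≤ max (nlMean x w) (nlMean y z) := by
  intro x y z w hx hxy hyz hzw hw
  have hy := hx.trans hxy
  have hz := hy.trans hyz
  have hw0 := hz.trans hzw
  have mono : ∀ {x' y' z' w' : ℝ}, x ≤ x' → x' ≤ 1 → y ≤ y' → y' ≤ 1 → z ≤ z' → z' ≤ 1 →
      w ≤ w' → w' ≤ 1 →
      nlMean (nlMean x y) (nlMean z w) ≤ nlMean (nlMean x' y') (nlMean z' w') := by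
    intro x' y' z' w' h1 h1' h2 h2' h3 h3' h4 h4'
    exact nlMean_mono (nlMean_nonneg hx hy) (nlMean_mono hx h1 h1' hy h2 h2')
      (nlMean_le_one (hx.trans h1) h1' (hy.trans h2) h2') (nlMean_nonneg hz hw0)
      (nlMean_mono hz h3 h3' hw0 h4 h4') (nlMean_le_one (hz.trans h3) h3' (hw0.trans h4) h4')
  rcases le_total (nlMean y z) (nlMean x w) with h | h
  · rw [max_eq_left h]
    have hxw : nlMean x w ≤ nlMean w w :=
      nlMean_mono_left hx (by linarith) hw0 hw
    obtain ⟨t, h0, h1, ht, hy1, hy2, hz1, hz2⟩ :=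
      exists_nlMean_segment_eq (hyz.trans hzw) hzw h hxw
    refine (mono le_rfl (by linarith) hy1 (by linarith) hz1 (by linarith) le_rfl hw).trans ?_
    exact nlMean_nlMean_le_of_eq hx (by linarith) (by nlinarith) hz2 hw rfl ht
  · rw [max_eq_right h]
    have hyz1 : nlMean y z ≤ nlMean y 1 :=
      nlMean_mono hy le_rfl (by linarith) hz (by linarith) le_rfl
    obtain ⟨t, h0, h1, ht, hx1, hx2, hw1, hw2⟩ := exists_nlMean_segment_eq hxy hw h hyz1
    refine (mono hx1 (by linarith) le_rfl (by linarith) le_rfl (by linarith) hw1 hw2).trans ?_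
    exact nlMean_nlMean_le_of_eq (by linarith) hx2 hyz (by linarith) hw2 ht rfl
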